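/- Let p be a prime, n an even positive integer, and s a positive integer with s ≤ n/2, where p is odd or s ≥ 2. Let {A_i : i ∈ V_s} be a partition of V_n into nonempty sets, let F : V_n → V_s be the function with F(x) = i iff x ∈ A_i, and assume F is a vectorial dual-bent function satisfying Condition A with sign ε ∈ {1,−1} (ε = 1 if p = 2). Then for every nonempty subset I ⊆ V_s, the set A_I \ {0}, where A_I = ⋃_{i ∈ I} A_i, is a (p^n, k, λ, μ) partial difference set in the additive group V_n, where if 0 ∈ A_I then (k, λ, μ) is parameter set (35) for |I| and ε, and if 0 ∉ A_I then (k, λ, μ) is parameter set (36) for |I| and ε. -/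

import Mathlib

open Finset

/-- `ζ_p^t = exp(2πi·t.val/p)` for `t : ZMod p`. -/
noncomputable def zetaP (p : ℕ) (t : ZMod p) : ℂ :=
  Complex.exp (2 * Real.pi * Complex.I * (t.val : ℂ) / (p : ℂ))

/-- The standard inner product on `V_n = Fin n → ZMod p`. -/
def ip {p n : ℕ} (a x : Fin n → ZMod p) : ZMod p := ∑ i, a i * x i

/-- The Walsh transform of `f : V_n → ZMod p`. -/
noncomputable def walsh {p n : ℕ} [NeZero p] (f : (Fin n → ZMod p) → ZMod p)
    (a : Fin n → ZMod p) : ℂ :=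
  ∑ x : Fin n → ZMod p, zetaP p (f x - ip a x)

/-- `F : V_n → V_s` is a vectorial dual-bent function satisfying Condition A with sign `ε`. -/
def ConditionA {n s : ℕ} (p : ℕ) [NeZero p]
    (F : (Fin n → ZMod p) → (Fin s → ZMod p)) (ε : ℤ) : Prop :=
  ∃ Fd : (Fin n → ZMod p) → (Fin s → ZMod p),
    ∀ c : Fin s → ZMod p, c ≠ 0 → ∀ a : Fin n → ZMod p,
      walsh (fun x => ip c (F x)) a = (ε : ℂ) * (p : ℂ) ^ (n / 2) * zetaP p (ip c (Fd a))

/-- `D` is a `(v, k, λ, μ)` partial difference set (with `klm = (k, λ, μ)`) in the finite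
abelian group `G`. -/
def IsPDS {G : Type*} [AddCommGroup G] [Fintype G] [DecidableEq G]
    (D : Finset G) (v : ℤ) (klm : ℤ × ℤ × ℤ) : Prop :=
  (Fintype.card G : ℤ) = v ∧ (D.card : ℤ) = klm.1 ∧
  (∀ g ∈ D, g ≠ 0 →
    ((((D ×ˢ D).filter (fun dd => dd.1 - dd.2 = g)).card : ℤ) = klm.2.1)) ∧
  (∀ g ∉ D, g ≠ (0 : G) →
    ((((D ×ˢ D).filter (fun dd => dd.1 - dd.2 = g)).card : ℤ) = klm.2.2))

/-- Parameter set (35) for `|I| = cI` and `ε`. -/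
def param35 (p n s : ℕ) (ε cI : ℤ) : ℤ × ℤ × ℤ :=
  ((p : ℤ) ^ (n - s) * cI + ε * (p : ℤ) ^ (n / 2 - s) * ((p : ℤ) ^ s - cI) - 1,
   (p : ℤ) ^ (n - 2 * s) * cI ^ 2 + ε * (p : ℤ) ^ (n / 2 - s) * ((p : ℤ) ^ s - cI) - 2,
   (p : ℤ) ^ (n - 2 * s) * cI ^ 2 + ε * (p : ℤ) ^ (n / 2 - s) * cI)

/-- Parameter set (36) for `|I| = cI` and `ε`. -/
def param36 (p n s : ℕ) (ε cI : ℤ) : ℤ × ℤ × ℤ :=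
  ((p : ℤ) ^ (n - s) * cI - ε * (p : ℤ) ^ (n / 2 - s) * cI,
   (p : ℤ) ^ (n - 2 * s) * cI ^ 2 + ε * (p : ℤ) ^ (n / 2 - s) * ((p : ℤ) ^ s - 3 * cI),
   (p : ℤ) ^ (n - 2 * s) * cI ^ 2 - ε * (p : ℤ) ^ (n / 2 - s) * cI)

open ComplexConjugate

lemma zetaP_eq_stdAddChar (p : ℕ) [NeZero p] (t : ZMod p) :
    zetaP p t = ZMod.stdAddChar t := by
  rw [zetaP, ZMod.stdAddChar_apply, ZMod.toCircle_apply]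

lemma zetaP_zero (p : ℕ) [NeZero p] : zetaP p 0 = 1 := by
  rw [zetaP_eq_stdAddChar, AddChar.map_zero_eq_one]

lemma zetaP_add (p : ℕ) [NeZero p] (t u : ZMod p) :
    zetaP p (t + u) = zetaP p t * zetaP p u := by
  simp only [zetaP_eq_stdAddChar, AddChar.map_add_eq_mul]

lemma conj_zetaP (p : ℕ) [NeZero p] (t : ZMod p) :
    conj (zetaP p t) = zetaP p (-t) := by
  simp only [zetaP_eq_stdAddChar, AddChar.map_neg_eq_conj]

section InnerProduct

variable {p k : ℕ}

lemma ip_zero_left (x : Fin k → ZMod p) : ip 0 x = 0 := by simp [ip]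

lemma ip_add_left (a b x : Fin k → ZMod p) : ip (a + b) x = ip a x + ip b x :=
  add_dotProduct a b x

lemma ip_sub_right (a x y : Fin k → ZMod p) : ip a (x - y) = ip a x - ip a y :=
  dotProduct_sub a x y

lemma ip_neg_right (a x : Fin k → ZMod p) : ip a (-x) = -ip a x :=
  dotProduct_neg a x

/-- Orthogonality of the additive characters of `V_k`. -/
lemma sum_zetaP_ip [NeZero p] (y : Fin k → ZMod p) :
    ∑ c, zetaP p (ip c y) = if y = 0 then (p : ℂ) ^ k else 0 := by
  let ψ : AddChar (Fin k → ZMod p) ℂ :=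
    { toFun := fun c => zetaP p (ip c y)
      map_zero_eq_one' := by rw [ip_zero_left, zetaP_zero]
      map_add_eq_mul' := fun a b => by rw [ip_add_left, zetaP_add] }
  have hψ : ψ = 0 ↔ y = 0 := by
    constructor
    · intro h
      funext j
      have hj : ψ (Pi.single j 1) = 1 := by rw [h]; rfl
      change zetaP p (ip (Pi.single j 1) y) = 1 at hj
      rw [show ip (Pi.single j 1) y = y j from single_one_dotProduct j y, zetaP_eq_stdAddChar,
        ← AddChar.map_zero_eq_one (ZMod.stdAddChar (N := p))] at hj
      exact ZMod.injective_stdAddChar hj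
    · rintro rfl
      ext c
      change zetaP p (ip c 0) = 1
      rw [show ip c (0 : Fin k → ZMod p) = 0 from dotProduct_zero c, zetaP_zero]
  have := AddChar.sum_eq_ite ψ
  rw [if_congr hψ rfl rfl] at this
  simpa [ψ, ZMod.card] using this

/-- Fourier inversion for the indicator function of `A`. -/
lemma sum_charSum_mul_zetaP [NeZero p] (A : Finset (Fin k → ZMod p)) (g : Fin k → ZMod p) :
    ∑ a, (∑ x ∈ A, zetaP p (-ip a x)) * zetaP p (ip a g) =
      (p : ℂ) ^ k * if g ∈ A then 1 else 0 := by
  simp_rw [Finset.sum_mul, ← zetaP_add]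
  rw [Finset.sum_comm]
  simp_rw [neg_add_eq_sub, ← ip_sub_right, sum_zetaP_ip, sub_eq_zero]
  simp

/-- The number of representations of `g` as a difference of two elements of `A`, in terms of the
squared absolute values of the character sums of `A`. -/
lemma sum_charSum_mul_conj_mul_zetaP [NeZero p] (A : Finset (Fin k → ZMod p))
    (g : Fin k → ZMod p) :
    ∑ a, (∑ x ∈ A, zetaP p (-ip a x)) * conj (∑ x ∈ A, zetaP p (-ip a x)) * zetaP p (ip a g) =
      (p : ℂ) ^ k * (#{d ∈ A ×ˢ A | d.1 - d.2 = g} : ℂ) := by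
  simp_rw [map_sum, conj_zetaP, neg_neg, Finset.sum_mul_sum, ← Finset.sum_product', Finset.sum_mul,
    ← zetaP_add]
  rw [Finset.sum_comm, Finset.card_filter, Nat.cast_sum, Finset.mul_sum]
  refine Finset.sum_congr rfl fun d _ => ?_
  have h : ∀ a, -ip a d.1 + ip a d.2 + ip a g = ip a (g - (d.1 - d.2)) := fun a => by
    simp only [ip_sub_right]; ring
  simp_rw [h, sum_zetaP_ip, sub_eq_zero, eq_comm (a := g)]
  split_ifs <;> simp

/-- A set all of whose character sums are real is closed under negation. -/
lemma neg_mem_of_charSum_real [NeZero p] {A : Finset (Fin k → ZMod p)}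
    {S : (Fin k → ZMod p) → ℤ} (hS : ∀ a, ∑ x ∈ A, zetaP p (-ip a x) = (S a : ℂ))
    {g : Fin k → ZMod p} (hg : g ∈ A) : -g ∈ A := by
  have h₁ := congrArg conj (sum_charSum_mul_zetaP A g)
  have h₂ := sum_charSum_mul_zetaP A (-g)
  simp_rw [hS, ip_neg_right] at h₁ h₂
  simp only [map_sum, map_mul, conj_zetaP, map_intCast, map_pow, map_natCast, hg, if_true,
    map_one] at h₁
  rw [h₁] at h₂
  by_contra hng
  simp [hng, NeZero.ne p] at h₂

/-- If the nontrivial character sums of `A` are integers taking only the values `r₁` and `r₂`, then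
the number of representations of `g` as a difference in `A` depends only on whether `g ∈ A` and
whether `g = 0`. -/
lemma card_differences_of_two_values [NeZero p] {A : Finset (Fin k → ZMod p)}
    {S : (Fin k → ZMod p) → ℤ} (hS : ∀ a, ∑ x ∈ A, zetaP p (-ip a x) = (S a : ℂ)) {r₁ r₂ : ℤ}
    (hr : ∀ a, a ≠ 0 → (S a - r₁) * (S a - r₂) = 0) (g : Fin k → ZMod p) :
    (p : ℤ) ^ k * (#{d ∈ A ×ˢ A | d.1 - d.2 = g} : ℤ) =
      (r₁ + r₂) * ((p : ℤ) ^ k * if g ∈ A then 1 else 0)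
        - r₁ * r₂ * (if g = 0 then (p : ℤ) ^ k else 0) + (S 0 - r₁) * (S 0 - r₂) := by
  have h₁ := sum_charSum_mul_zetaP A g
  have h₂ := sum_charSum_mul_conj_mul_zetaP A g
  have h₃ := sum_zetaP_ip g
  simp_rw [hS] at h₁ h₂
  simp only [map_intCast] at h₂
  have h : ∑ a, (((S a - r₁) * (S a - r₂) : ℤ) : ℂ) * zetaP p (ip a g) =
      (((S 0 - r₁) * (S 0 - r₂) : ℤ) : ℂ) := by
    rw [Finset.sum_eq_single 0 (fun a _ ha => by rw [hr a ha]; simp) (by simp), ip_zero_left,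
      zetaP_zero, mul_one]
  have h' : ∑ a, (((S a - r₁) * (S a - r₂) : ℤ) : ℂ) * zetaP p (ip a g) =
      ∑ a, (S a : ℂ) * S a * zetaP p (ip a g) - (r₁ + r₂) * ∑ a, (S a : ℂ) * zetaP p (ip a g)
        + r₁ * r₂ * ∑ a, zetaP p (ip a g) := by
    simp only [Finset.mul_sum, ← Finset.sum_sub_distrib, ← Finset.sum_add_distrib]
    refine Finset.sum_congr rfl fun a _ => ?_
    push_cast
    ring
  rw [h', h₁, h₂, h₃] at h
  have key : ((p : ℂ) ^ k * (#{d ∈ A ×ˢ A | d.1 - d.2 = g} : ℂ)) =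
      (r₁ + r₂) * ((p : ℂ) ^ k * if g ∈ A then 1 else 0)
        - r₁ * r₂ * (if g = 0 then (p : ℂ) ^ k else 0)
        + (((S 0 - r₁) * (S 0 - r₂) : ℤ) : ℂ) := by
    linear_combination h
  exact_mod_cast key

end InnerProduct

/-- The character sums of a union of fibres of a function whose nonzero component functions have
Walsh transform `B * ζ_p ^ ⟨c, Fd a⟩`. -/
lemma charSum_preimage {p n s : ℕ} [NeZero p] {F Fd : (Fin n → ZMod p) → (Fin s → ZMod p)} {B : ℂ}
    (hW : ∀ c : Fin s → ZMod p, c ≠ 0 → ∀ a,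
      walsh (fun x => ip c (F x)) a = B * zetaP p (ip c (Fd a)))
    (I : Finset (Fin s → ZMod p)) (a : Fin n → ZMod p) :
    (p : ℂ) ^ s * ∑ x with F x ∈ I, zetaP p (-ip a x) =
      (#I : ℂ) * ((if a = 0 then (p : ℂ) ^ n else 0) - B)
        + B * (p : ℂ) ^ s * (if Fd a ∈ I then 1 else 0) := by
  have hW' : ∀ c, walsh (fun x => ip c (F x)) a = B * zetaP p (ip c (Fd a)) +
      if c = 0 then (if a = 0 then (p : ℂ) ^ n else 0) - B else 0 := by
    intro c
    split_ifs with hc ha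
    · simp [walsh, hc, ha, ip_zero_left, zetaP_zero, ZMod.card]
    · have h := sum_zetaP_ip (p := p) (-a)
      rw [if_neg (neg_ne_zero.mpr ha)] at h
      have hcomm : ∀ x, ip x a = ip a x := fun x => dotProduct_comm x a
      simp_rw [ip_neg_right, hcomm] at h
      simp [walsh, hc, ip_zero_left, zetaP_zero, h]
    · rw [hW c hc, add_zero]
  have hi : ∀ i, ∑ x, (∑ c, zetaP p (ip c (F x - i))) * zetaP p (-ip a x) =
      B * (if Fd a = i then (p : ℂ) ^ s else 0) + ((if a = 0 then (p : ℂ) ^ n else 0) - B) := by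
    intro i
    have h₁ : ∀ c, ∑ x, zetaP p (ip c (F x - i)) * zetaP p (-ip a x) =
        zetaP p (-ip c i) * walsh (fun x => ip c (F x)) a := by
      intro c
      rw [walsh, Finset.mul_sum]
      refine Finset.sum_congr rfl fun x _ => ?_
      rw [← zetaP_add, ← zetaP_add, ip_sub_right]
      congr 1
      ring
    have h₂ : ∀ c, zetaP p (-ip c i) * (B * zetaP p (ip c (Fd a))) =
        B * zetaP p (ip c (Fd a - i)) := by
      intro c
      rw [ip_sub_right, sub_eq_neg_add, zetaP_add]
      ring
    simp_rw [Finset.sum_mul]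
    rw [Finset.sum_comm]
    simp_rw [h₁, hW', mul_add, Finset.sum_add_distrib, h₂, ← Finset.mul_sum, sum_zetaP_ip,
      sub_eq_zero]
    simp [ip_zero_left, zetaP_zero]
  have hsum := Finset.sum_congr (rfl : I = I) fun i _ => hi i
  simp_rw [sum_zetaP_ip, sub_eq_zero] at hsum
  rw [Finset.sum_comm] at hsum
  simp only [← Finset.sum_mul, Finset.sum_add_distrib, ← Finset.mul_sum, Finset.sum_ite_eq,
    Finset.sum_const, nsmul_eq_mul] at hsum
  rw [Finset.sum_filter, Finset.mul_sum]
  convert hsum using 1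
  · refine Finset.sum_congr rfl fun x _ => ?_
    split_ifs <;> simp
  · split_ifs <;> ring

/-- Removing `0` from a symmetric set that contains it destroys exactly the two representations
`g - 0` and `0 - (-g)` of each nonzero element `g` of the set as a difference. -/
lemma card_differences_erase_zero {G : Type*} [AddCommGroup G] [DecidableEq G] {A : Finset G}
    (h0 : 0 ∈ A) (hneg : ∀ g ∈ A, -g ∈ A) {g : G} (hg : g ≠ 0) :
    #{d ∈ A ×ˢ A | d.1 - d.2 = g} =
      #{d ∈ A.erase 0 ×ˢ A.erase 0 | d.1 - d.2 = g} + if g ∈ A then 2 else 0 := by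
  have hneg' : -g ∈ A ↔ g ∈ A := ⟨fun h => by simpa using hneg _ h, hneg g⟩
  rw [← Finset.card_filter_add_card_filter_not (s := {d ∈ A ×ˢ A | d.1 - d.2 = g})
    (fun d => d.1 ≠ 0 ∧ d.2 ≠ 0)]
  congr 1
  · congr 1
    ext d
    simp only [mem_filter, mem_product, mem_erase]
    tauto
  · split_ifs with h
    · have : ((g, 0) : G × G) ≠ (0, -g) := by simp [hg]
      rw [← Finset.card_pair this]
      congr 1
      ext ⟨x, y⟩
      simp only [mem_filter, mem_product, mem_insert, mem_singleton, Prod.mk.injEq]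
      constructor
      · rintro ⟨⟨⟨hx, hy⟩, hxy⟩, hne⟩
        by_cases hx0 : x = 0
        · right; subst hx0; refine ⟨rfl, ?_⟩; rw [← hxy]; simp
        · left
          have hy0 : y = 0 := by tauto
          subst hy0
          simpa using hxy
      · rintro (⟨rfl, rfl⟩ | ⟨rfl, rfl⟩)
        · simp [h, h0]
        · simp [h0, hneg', h]
    · rw [Finset.card_eq_zero, Finset.filter_eq_empty_iff]
      rintro ⟨x, y⟩ hd
      simp only [mem_filter, mem_product] at hd
      obtain ⟨⟨hx, hy⟩, hxy⟩ := hd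
      rw [not_not]
      refine ⟨?_, ?_⟩
      · rintro rfl
        apply h
        rw [← hxy, zero_sub]
        exact hneg _ hy
      · rintro rfl
        apply h
        rw [← hxy, sub_zero]
        exact hx

theorem stmt14 (p : ℕ) [Fact p.Prime] (n s : ℕ) (hn : 0 < n) (hneven : Even n)
    (hs : 0 < s) (hsn : s ≤ n / 2) (hps : Odd p ∨ 2 ≤ s)
    (ε : ℤ) (hε : ε = 1 ∨ ε = -1) (hε2 : p = 2 → ε = 1)
    -- a partition of `V_n` into nonempty sets `A i`, with `F x = i ↔ x ∈ A i`
    (A : (Fin s → ZMod p) → Finset (Fin n → ZMod p))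
    (hA : ∀ i, (A i).Nonempty)
    (F : (Fin n → ZMod p) → (Fin s → ZMod p))
    (hFA : ∀ x i, F x = i ↔ x ∈ A i)
    -- `F` is vectorial dual-bent satisfying Condition A with sign `ε`
    (hF : ConditionA p F ε) :
    ∀ I : Finset (Fin s → ZMod p), I.Nonempty →
      ((0 : Fin n → ZMod p) ∈ I.biUnion A →
        IsPDS ((I.biUnion A).erase 0) ((p : ℤ) ^ n) (param35 p n s ε I.card)) ∧
      ((0 : Fin n → ZMod p) ∉ I.biUnion A →
        IsPDS ((I.biUnion A).erase 0) ((p : ℤ) ^ n) (param36 p n s ε I.card)) := by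
  obtain ⟨Fd, hW⟩ := hF
  have hp : 1 < p := (Fact.out : p.Prime).one_lt
  have hε1 : ε * ε = 1 := by rcases hε with rfl | rfl <;> rfl
  obtain ⟨m, hm⟩ := Nat.exists_eq_add_of_le hsn
  have hn2 : n = s + s + m + m := by obtain ⟨r, hr⟩ := hneven; omega
  set P : ℤ := (p : ℤ) ^ s with hP
  set q : ℤ := (p : ℤ) ^ m with hq
  have hP0 : P ≠ 0 := pow_ne_zero _ (by positivity)
  have hq0 : q ≠ 0 := pow_ne_zero _ (by positivity)
  have e_n : (p : ℤ) ^ n = q * q * P * P := by rw [hn2, hP, hq]; ring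
  have e_half : (p : ℤ) ^ (n / 2) = q * P := by rw [hm, hP, hq]; ring
  have e_half_sub : (p : ℤ) ^ (n / 2 - s) = q := by rw [hm, hq]; congr 1; omega
  have e_sub : (p : ℤ) ^ (n - s) = q * q * P := by
    rw [hP, hq, ← pow_add, ← pow_add]; congr 1; omega
  have e_sub_two : (p : ℤ) ^ (n - 2 * s) = q * q := by
    rw [hq, ← pow_add]; congr 1; omega
  have hP2 : P ≠ 2 := by
    intro h
    have h2 : p ^ s = 2 := by rw [hP] at h; exact_mod_cast h
    rcases hps with hodd | hs2
    · exact absurd (h2 ▸ hodd.pow : Odd 2) (by decide)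
    · have := Nat.pow_le_pow_left (show 2 ≤ p from hp) s
      have := Nat.pow_le_pow_right (show 0 < 2 by norm_num) hs2
      omega
  have hunion : ∀ I : Finset (Fin s → ZMod p), I.biUnion A = univ.filter (fun x => F x ∈ I) := by
    intro I
    ext x
    simp [← hFA]
  let S (I : Finset (Fin s → ZMod p)) (a : Fin n → ZMod p) : ℤ :=
    (if a = 0 then q * q * P * #I else 0) - ε * q * #I + if Fd a ∈ I then ε * q * P else 0
  have hS : ∀ I a, ∑ x ∈ I.biUnion A, zetaP p (-ip a x) = (S I a : ℂ) := by
    intro I a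
    have h := charSum_preimage hW I a
    rw [← hunion] at h
    have hPC : (p : ℂ) ^ s = (P : ℂ) := by rw [hP]; push_cast; rfl
    have hhC : (p : ℂ) ^ (n / 2) = (q : ℂ) * P := by exact_mod_cast congrArg (Int.cast (R := ℂ)) e_half
    have hnC : (p : ℂ) ^ n = (q : ℂ) * q * P * P := by exact_mod_cast congrArg (Int.cast (R := ℂ)) e_n
    rw [hPC, hhC, hnC] at h
    refine mul_left_cancel₀ (Int.cast_ne_zero.mpr hP0 : (P : ℂ) ≠ 0) (h.trans ?_)
    simp only [S]
    push_cast
    split_ifs <;> ring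
  have hr : ∀ I a, a ≠ 0 → (S I a - (ε * q * P - ε * q * #I)) * (S I a - (-(ε * q * #I))) = 0 := by
    intro I a ha
    simp only [S, if_neg ha]
    split_ifs <;> ring
  have hcard : ∀ I : Finset (Fin s → ZMod p), (#(I.biUnion A) : ℤ) = S I 0 := by
    intro I
    have h := hS I 0
    simp only [ip_zero_left, neg_zero, zetaP_zero, Finset.sum_const, nsmul_eq_mul, mul_one] at h
    exact_mod_cast h
  have hdiff := fun I => card_differences_of_two_values (hS I) (hr I)
  have hF0 : F 0 = Fd 0 := by
    have h := hdiff {Fd 0} 0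
    have hdiag : #{d ∈ ({Fd 0} : Finset _).biUnion A ×ˢ ({Fd 0} : Finset _).biUnion A |
        d.1 - d.2 = 0} = #(({Fd 0} : Finset _).biUnion A) := by
      simp_rw [sub_eq_zero]
      rw [← Finset.diag_eq_filter, Finset.diag_card]
    rw [hdiag, hcard, e_n] at h
    by_contra hne
    have h0 : (0 : Fin n → ZMod p) ∉ ({Fd 0} : Finset _).biUnion A := by
      simpa [← hFA] using hne
    rw [if_neg h0] at h
    simp only [S, if_true, card_singleton, mem_singleton, Nat.cast_one, mul_one] at h
    have hfac : ε * q * q * q * P * P * (P - 2) = 0 := by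
      linear_combination h + q * q * q * q * P * P * (P - 1) * hε1
    have hε0 : ε ≠ 0 := by rintro rfl; simp at hε1
    simp [hε0, hq0, hP0, sub_eq_zero, hP2] at hfac
  have hmem : ∀ I : Finset (Fin s → ZMod p), (0 : Fin n → ZMod p) ∈ I.biUnion A ↔ Fd 0 ∈ I := by
    intro I
    rw [hunion, mem_filter, hF0]
    simp
  have hpn : q * q * P * P ≠ 0 := by simp [hq0, hP0]
  have hG : (Fintype.card (Fin n → ZMod p) : ℤ) = (p : ℤ) ^ n := by simp [ZMod.card]
  intro I _
  refine ⟨fun h0 => ?_, fun h0 => ?_⟩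
  · have hN := fun g (hg : g ≠ 0) => card_differences_erase_zero h0
      (fun _ => neg_mem_of_charSum_real (hS I)) hg
    have hS0 : S I 0 = q * q * P * #I - ε * q * #I + ε * q * P := by
      simp [S, (hmem I).1 h0]
    refine ⟨hG, ?_, fun g hg hg0 => ?_, fun g hg hg0 => ?_⟩
    · have h := Finset.card_erase_add_one h0
      have hc := hcard I
      rw [← h, hS0] at hc
      simp only [param35, e_half_sub, e_sub]
      push_cast at hc
      linear_combination hc
    all_goals
      have hgA := hg
      simp only [mem_erase, ne_eq, hg0, not_false_eq_true, true_and] at hgA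
      have h := hdiff I g
      have h' := hN g hg0
      simp only [hgA, hg0, if_true, if_false] at h h'
      rw [h', hS0, e_n] at h
      push_cast at h
      simp only [param35, e_half_sub, e_sub_two]
      refine mul_left_cancel₀ hpn ?_
      linear_combination h
  · have hS0 : S I 0 = q * q * P * #I - ε * q * #I := by
      simp [S, mt (hmem I).2 h0]
    rw [Finset.erase_eq_of_notMem h0]
    refine ⟨hG, ?_, fun g hg hg0 => ?_, fun g hg hg0 => ?_⟩
    · rw [hcard I, hS0]
      simp only [param36, e_half_sub, e_sub]
    all_goals
      have h := hdiff I g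
      simp only [hg, hg0, if_true, if_false] at h
      rw [hS0, e_n] at h
      simp only [param36, e_half_sub, e_sub_two]
      refine mul_left_cancel₀ hpn ?_
      linear_combination h
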